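/- Every optimal set of two-means for the condensation measure P equals {659/2730, 1621/1950}, and the second quantization error of P is V_2(P) = 499067/18505500. -/

import Mathlib

open MeasureTheory Metric Set Filter

/-- The distortion error of a set `α` of quantizer points for `μ`, of order 2:
`∫ min_{a ∈ α} (x - a)^2 dμ(x)`. -/
noncomputable def distortion (μ : MeasureTheory.Measure ℝ) (α : Set ℝ) : ℝ :=
  ∫ x, (Metric.infDist x α) ^ 2 ∂μ

/-- The `n`th quantization error of order 2 for `μ`. -/
noncomputable def quantErr (μ : MeasureTheory.Measure ℝ) (n : ℕ) : ℝ :=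
  sInf {e : ℝ | ∃ α : Set ℝ, α.Finite ∧ α.Nonempty ∧ α.ncard ≤ n ∧ e = distortion μ α}

/-- `α` is an optimal set of `n`-means for `μ`. -/
def IsOptimalSet (μ : MeasureTheory.Measure ℝ) (n : ℕ) (α : Set ℝ) : Prop :=
  α.Finite ∧ α.Nonempty ∧ α.ncard ≤ n ∧ distortion μ α = quantErr μ n

/-- The similarity `S₁(x) = x/5`. -/
noncomputable def S1 : ℝ → ℝ := fun x => x / 5

/-- The similarity `S₂(x) = x/5 + 4/5`. -/
noncomputable def S2 : ℝ → ℝ := fun x => x / 5 + 4 / 5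

/-- `P` is the condensation measure associated with `(S₁, S₂; 1/3, 1/3, 1/3; ν)`:
`P = (1/3) P∘S₁⁻¹ + (1/3) P∘S₂⁻¹ + (1/3) ν`. -/
def IsCondensation (P ν : MeasureTheory.Measure ℝ) : Prop :=
  MeasureTheory.IsProbabilityMeasure P ∧
    P = (1 / 3 : ENNReal) • P.map S1 + (1 / 3 : ENNReal) • P.map S2 + (1 / 3 : ENNReal) • ν

/-- The point `a_{j+1} = 3/5 - 1/(5 · 2^j)` (so `aseq 0 = a₁ = 2/5`). -/
noncomputable def aseq (j : ℕ) : ℝ := 3 / 5 - 1 / (5 * 2 ^ j)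

/-- The infinite discrete distribution `ν = ∑_{j ≥ 1} 2^{-j} δ_{a_j}`. -/
noncomputable def nuDisc : MeasureTheory.Measure ℝ :=
  MeasureTheory.Measure.sum
    (fun j : ℕ => ((1 / 2 : ENNReal) ^ (j + 1)) • MeasureTheory.Measure.dirac (aseq j))

lemma infDist_pair_sq (x a b : ℝ) :
    infDist x {a, b} ^ 2 = min ((x - a) ^ 2) ((x - b) ^ 2) := by
  obtain ⟨y, hy, h⟩ := (Set.toFinite ({a, b} : Set ℝ)).isCompact.exists_infDist_eq_dist
    ⟨a, by simp⟩ x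
  have ha : infDist x {a, b} ≤ |x - a| := infDist_le_dist_of_mem (by simp)
  have hb : infDist x {a, b} ≤ |x - b| := infDist_le_dist_of_mem (by simp)
  have h0 : 0 ≤ infDist x {a, b} := infDist_nonneg
  have ha' := pow_le_pow_left₀ h0 ha 2
  have hb' := pow_le_pow_left₀ h0 hb 2
  rw [sq_abs] at ha' hb'
  refine le_antisymm (le_min ha' hb') ?_
  rw [h, Real.dist_eq, sq_abs]
  rcases hy with rfl | hy
  · exact min_le_left _ _
  · rw [Set.mem_singleton_iff.1 hy]
    exact min_le_right _ _

lemma ae_nuDisc {p : ℝ → Prop} (h : ∀ j, p (aseq j)) : ∀ᵐ x ∂nuDisc, p x := by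
  rw [nuDisc, Measure.ae_sum_eq, eventually_iSup]
  intro j
  refine Measure.ae_smul_measure ?_ _
  rw [ae_dirac_eq]
  exact h j

lemma aseq_mem (j : ℕ) : 2 / 5 ≤ aseq j ∧ aseq j < 3 / 5 := by
  have h1 : (1 : ℝ) ≤ 2 ^ j := one_le_pow₀ (by norm_num)
  have h2 : 0 < 1 / (5 * (2 : ℝ) ^ j) := by positivity
  have h3 : 1 / (5 * (2 : ℝ) ^ j) ≤ 1 / 5 := by
    apply one_div_le_one_div_of_le <;> linarith
  unfold aseq
  constructor <;> linarith

lemma aseq_eq (j : ℕ) : aseq j = 3 / 5 - 1 / 5 * (1 / 2) ^ j := by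
  unfold aseq
  rw [one_div_pow]
  field_simp

lemma monotone_aseq : Monotone aseq := by
  intro i j hij
  rw [aseq_eq, aseq_eq]
  have : (1 / 2 : ℝ) ^ j ≤ (1 / 2) ^ i :=
    pow_le_pow_of_le_one (by norm_num) (by norm_num) hij
  linarith

lemma hasSum_integral_nuDisc {f : ℝ → ℝ} (hf : Integrable f nuDisc) :
    HasSum (fun j : ℕ => (1 / 2 : ℝ) ^ (j + 1) * f (aseq j)) (∫ x, f x ∂nuDisc) := by
  have h := hasSum_integral_measure hf
  refine h.congr_fun ?_
  intro j
  simp [integral_smul_measure]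

lemma hasSum_geometric_scaled {r : ℝ} (h0 : 0 ≤ r) (h1 : r < 1) :
    HasSum (fun j : ℕ => (1 / 2) * r ^ j) ((1 / 2) * (1 - r)⁻¹) :=
  (hasSum_geometric_of_lt_one h0 h1).mul_left _


lemma measurable_S1 : Measurable S1 := by unfold S1; fun_prop

lemma measurable_S2 : Measurable S2 := by unfold S2; fun_prop

namespace IsCondensation

lemma measureReal_eq {P : Measure ℝ} (hP : IsCondensation P nuDisc) {s : Set ℝ}
    (hs : MeasurableSet s) (hν : nuDisc s = 0) :
    P.real s = 1 / 3 * P.real (S1 ⁻¹' s) + 1 / 3 * P.real (S2 ⁻¹' s) := by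
  have := hP.1
  have h := congrArg (fun μ : Measure ℝ => μ s) hP.2
  simp only [Measure.add_apply, Measure.smul_apply, hν, smul_eq_mul, mul_zero, add_zero,
    Measure.map_apply measurable_S1 hs, Measure.map_apply measurable_S2 hs] at h
  have h' := congrArg ENNReal.toReal h
  rw [ENNReal.toReal_add (by finiteness) (by finiteness)] at h'
  simpa [Measure.real] using h'

lemma ae_mem_Icc {P : Measure ℝ} (hP : IsCondensation P nuDisc) :
    ∀ᵐ x ∂P, x ∈ Icc (0 : ℝ) 1 := by
  have := hP.1
  have h0 : P.real (Iio 0) = 0 := by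
    have hν : nuDisc (Iio 0) = 0 := by
      have : ∀ᵐ x ∂nuDisc, x ∉ Iio (0 : ℝ) := ae_nuDisc fun j => by
        have := (aseq_mem j).1
        simp only [mem_Iio, not_lt]
        linarith
      exact measure_eq_zero_iff_ae_notMem.2 this
    have h := hP.measureReal_eq measurableSet_Iio hν
    have h1 : P.real (S1 ⁻¹' Iio 0) ≤ P.real (Iio 0) := measureReal_mono fun x hx => by
      simp only [S1, mem_preimage, mem_Iio] at hx ⊢
      linarith
    have h2 : P.real (S2 ⁻¹' Iio 0) ≤ P.real (Iio 0) := measureReal_mono fun x hx => by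
      simp only [S2, mem_preimage, mem_Iio] at hx ⊢
      linarith
    have h3 : 0 ≤ P.real (Iio 0) := measureReal_nonneg
    linarith
  have h1 : P.real (Ioi 1) = 0 := by
    have hν : nuDisc (Ioi 1) = 0 := by
      have : ∀ᵐ x ∂nuDisc, x ∉ Ioi (1 : ℝ) := ae_nuDisc fun j => by
        have := (aseq_mem j).2
        simp only [mem_Ioi, not_lt]
        linarith
      exact measure_eq_zero_iff_ae_notMem.2 this
    have h := hP.measureReal_eq measurableSet_Ioi hν
    have h1 : P.real (S1 ⁻¹' Ioi 1) ≤ P.real (Ioi 1) := measureReal_mono fun x hx => by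
      simp only [S1, mem_preimage, mem_Ioi] at hx ⊢
      linarith
    have h2 : P.real (S2 ⁻¹' Ioi 1) ≤ P.real (Ioi 1) := measureReal_mono fun x hx => by
      simp only [S2, mem_preimage, mem_Ioi] at hx ⊢
      linarith
    have h3 : 0 ≤ P.real (Ioi 1) := measureReal_nonneg
    linarith
  rw [measureReal_eq_zero_iff] at h0 h1
  filter_upwards [measure_eq_zero_iff_ae_notMem.1 h0, measure_eq_zero_iff_ae_notMem.1 h1] with x hx hx'
  simp only [mem_Iio, mem_Ioi, not_lt] at hx hx'
  exact ⟨hx, hx'⟩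

lemma integrable {P : Measure ℝ} (hP : IsCondensation P nuDisc) {f : ℝ → ℝ}
    (hf : Continuous f) : Integrable f P := by
  have := hP.1
  rw [← Measure.restrict_eq_self_of_ae_mem hP.ae_mem_Icc]
  exact hf.continuousOn.integrableOn_compact isCompact_Icc

lemma integrable_nuDisc {P : Measure ℝ} (hP : IsCondensation P nuDisc) {f : ℝ → ℝ}
    (hf : Continuous f) : Integrable f nuDisc := by
  have h := hP.integrable hf
  rw [hP.2, integrable_add_measure] at h
  exact (integrable_smul_measure (by simp) (by simp)).1 h.2

lemma integral_eq {P : Measure ℝ} (hP : IsCondensation P nuDisc) {f : ℝ → ℝ}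
    (hf : Continuous f) :
    ∫ x, f x ∂P = 1 / 3 * ((∫ x, f (x / 5) ∂P) + (∫ x, f (x / 5 + 4 / 5) ∂P)
      + ∫ x, f x ∂nuDisc) := by
  have h := hP.integrable hf
  rw [hP.2, integrable_add_measure, integrable_add_measure] at h
  conv_lhs => rw [hP.2]
  rw [integral_add_measure (integrable_add_measure.2 h.1) h.2,
    integral_add_measure h.1.1 h.1.2, integral_smul_measure, integral_smul_measure,
    integral_smul_measure, integral_map measurable_S1.aemeasurable hf.aestronglyMeasurable,
    integral_map measurable_S2.aemeasurable hf.aestronglyMeasurable]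
  simp only [S1, S2, smul_eq_mul, ENNReal.toReal_div, ENNReal.toReal_one, ENNReal.toReal_ofNat]
  ring

lemma integral_affine_sq {P : Measure ℝ} (hP : IsCondensation P nuDisc) (u v : ℝ) :
    ∫ x, (u * x + v) ^ 2 ∂P = u ^ 2 * (∫ x, x ^ 2 ∂P) + 2 * u * v * (∫ x, x ∂P) + v ^ 2 := by
  have := hP.1
  have h1 : Integrable (fun x : ℝ => u ^ 2 * x ^ 2) P := hP.integrable (by fun_prop)
  have h2 : Integrable (fun x : ℝ => 2 * u * v * x) P := hP.integrable (by fun_prop)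
  have h : ∀ x : ℝ, (u * x + v) ^ 2 = u ^ 2 * x ^ 2 + 2 * u * v * x + v ^ 2 :=
    fun x => by ring
  simp_rw [h]
  rw [integral_add (hP.integrable (by fun_prop)) (integrable_const _), integral_add h1 h2,
    integral_const_mul, integral_const_mul]
  simp

lemma integral_nuDisc_sub_sq {P : Measure ℝ} (hP : IsCondensation P nuDisc) (t : ℝ) :
    ∫ x, (x - t) ^ 2 ∂nuDisc = 39 / 175 - 2 * t * (7 / 15) + t ^ 2 := by
  have h := hasSum_integral_nuDisc (hP.integrable_nuDisc (f := fun x => (x - t) ^ 2)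
    (by fun_prop))
  have g1 := hasSum_geometric_scaled (r := 1 / 2) (by norm_num) (by norm_num)
  have g2 := hasSum_geometric_scaled (r := 1 / 4) (by norm_num) (by norm_num)
  have g3 := hasSum_geometric_scaled (r := 1 / 8) (by norm_num) (by norm_num)
  have g := ((g1.mul_left ((3 / 5 - t) ^ 2)).sub (g2.mul_left (2 / 5 * (3 / 5 - t)))).add
    (g3.mul_left (1 / 25))
  refine (h.unique (g.congr_fun fun j => ?_)).trans (by ring)
  have e4 : (1 / 4 : ℝ) ^ j = ((1 / 2) ^ j) ^ 2 := by rw [← pow_mul, mul_comm, pow_mul]; norm_num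
  have e8 : (1 / 8 : ℝ) ^ j = ((1 / 2) ^ j) ^ 3 := by rw [← pow_mul, mul_comm, pow_mul]; norm_num
  rw [aseq_eq, e4, e8, pow_succ]
  ring

lemma integral_nuDisc_id {P : Measure ℝ} (hP : IsCondensation P nuDisc) :
    ∫ x, x ∂nuDisc = 7 / 15 := by
  have h := hasSum_integral_nuDisc (hP.integrable_nuDisc (f := fun x => x) (by fun_prop))
  have g1 := hasSum_geometric_scaled (r := 1 / 2) (by norm_num) (by norm_num)
  have g2 := hasSum_geometric_scaled (r := 1 / 4) (by norm_num) (by norm_num)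
  have g := (g1.mul_left (3 / 5)).sub (g2.mul_left (1 / 5))
  refine (h.unique (g.congr_fun fun j => ?_)).trans (by ring)
  have e4 : (1 / 4 : ℝ) ^ j = ((1 / 2) ^ j) ^ 2 := by rw [← pow_mul, mul_comm, pow_mul]; norm_num
  rw [aseq_eq, e4, pow_succ]
  ring

lemma integral_id {P : Measure ℝ} (hP : IsCondensation P nuDisc) :
    ∫ x, x ∂P = 19 / 39 := by
  have := hP.1
  have h := hP.integral_eq (f := fun x => x) (by fun_prop)
  have h1 : Integrable (fun x : ℝ => x / 5) P := hP.integrable (by fun_prop)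
  rw [hP.integral_nuDisc_id, integral_add h1 (integrable_const _), integral_div] at h
  simp only [integral_const, probReal_univ, one_smul] at h
  linarith

lemma integral_sq {P : Measure ℝ} (hP : IsCondensation P nuDisc) :
    ∫ x, x ^ 2 ∂P = 6953 / 19929 := by
  have h := hP.integral_eq (f := fun x => x ^ 2) (by fun_prop)
  have h1 := hP.integral_affine_sq (1 / 5) 0
  have h2 := hP.integral_affine_sq (1 / 5) (4 / 5)
  have h3 := hP.integral_nuDisc_sub_sq 0
  have e1 : ∀ x : ℝ, 1 / 5 * x = x / 5 := fun x => by ring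
  simp only [e1, add_zero, sub_zero] at h1 h2 h3
  rw [h1, h2, h3, hP.integral_id] at h
  linarith

lemma integral_S1_sub_sq {P : Measure ℝ} (hP : IsCondensation P nuDisc) (t : ℝ) :
    ∫ x, (x / 5 - t) ^ 2 ∂P = 6953 / 498225 - 2 * t * (19 / 195) + t ^ 2 := by
  have h := hP.integral_affine_sq (1 / 5) (-t)
  rw [hP.integral_id, hP.integral_sq] at h
  convert h using 1
  · congr 1; ext x; ring
  · ring

lemma integral_S2_sub_sq {P : Measure ℝ} (hP : IsCondensation P nuDisc) (t : ℝ) :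
    ∫ x, (x / 5 + 4 / 5 - t) ^ 2 ∂P =
      6953 / 498225 + 152 / 975 + 16 / 25 - 2 * t * (175 / 195) + t ^ 2 := by
  have h := hP.integral_affine_sq (1 / 5) (4 / 5 - t)
  rw [hP.integral_id, hP.integral_sq] at h
  convert h using 1
  · congr 1; ext x; ring
  · ring

lemma distortion_pair {P : Measure ℝ} (hP : IsCondensation P nuDisc) (a b : ℝ) :
    3 * distortion P {a, b} = (∫ x, min ((x / 5 - a) ^ 2) ((x / 5 - b) ^ 2) ∂P)
      + (∫ x, min ((x / 5 + 4 / 5 - a) ^ 2) ((x / 5 + 4 / 5 - b) ^ 2) ∂P)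
      + ∫ x, min ((x - a) ^ 2) ((x - b) ^ 2) ∂nuDisc := by
  unfold distortion
  simp_rw [infDist_pair_sq]
  rw [hP.integral_eq (f := fun x => min ((x - a) ^ 2) ((x - b) ^ 2)) (by fun_prop)]
  ring

end IsCondensation

lemma min_sq_eq_left {x a b : ℝ} (hab : a ≤ b) (hx : 2 * x ≤ a + b) :
    min ((x - a) ^ 2) ((x - b) ^ 2) = (x - a) ^ 2 :=
  min_eq_left (by nlinarith)

lemma min_sq_eq_right {x a b : ℝ} (hab : a ≤ b) (hx : a + b ≤ 2 * x) :
    min ((x - a) ^ 2) ((x - b) ^ 2) = (x - b) ^ 2 :=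
  min_eq_right (by nlinarith)

lemma sum_range_weight (k : ℕ) :
    ∑ j ∈ Finset.range k, (1 / 2 : ℝ) ^ (j + 1) = 1 - (1 / 2) ^ k := by
  induction k with
  | zero => simp
  | succ k ih => rw [Finset.sum_range_succ, ih]; ring

lemma sum_range_weight_mul_aseq (k : ℕ) :
    ∑ j ∈ Finset.range k, (1 / 2 : ℝ) ^ (j + 1) * aseq j =
      3 / 5 * (1 - (1 / 2) ^ k) - 2 / 15 * (1 - ((1 / 2) ^ k) ^ 2) := by
  induction k with
  | zero => simp
  | succ k ih => rw [Finset.sum_range_succ, ih, aseq_eq]; ring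

/-- Three times the distortion of `{a, b}` when `a` serves the atoms of `nuDisc` carrying all
but a fraction `q` of its mass. -/
noncomputable def splitDistortion (q a b : ℝ) : ℝ :=
  (6953 / 498225 - 2 * a * (19 / 195) + a ^ 2)
    + (6953 / 498225 + 152 / 975 + 16 / 25 - 2 * b * (175 / 195) + b ^ 2)
    + (39 / 175 - 2 * b * (7 / 15) + b ^ 2)
    + ((1 - q) * (a ^ 2 - b ^ 2)
      - 2 * (a - b) * (3 / 5 * (1 - q) - 2 / 15 * (1 - q ^ 2)))

namespace IsCondensation

lemma integral_nuDisc_min {P : Measure ℝ} (hP : IsCondensation P nuDisc) {a b : ℝ}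
    (hab : a ≤ b) {k : ℕ} (hl : ∀ j < k, 2 * aseq j ≤ a + b)
    (hr : ∀ j, k ≤ j → a + b ≤ 2 * aseq j) :
    ∫ x, min ((x - a) ^ 2) ((x - b) ^ 2) ∂nuDisc = (39 / 175 - 2 * b * (7 / 15) + b ^ 2)
      + ((1 - (1 / 2) ^ k) * (a ^ 2 - b ^ 2)
      - 2 * (a - b) * (3 / 5 * (1 - (1 / 2) ^ k) - 2 / 15 * (1 - ((1 / 2) ^ k) ^ 2))) := by
  have h := hasSum_integral_nuDisc (hP.integrable_nuDisc
    (f := fun x => min ((x - a) ^ 2) ((x - b) ^ 2)) (by fun_prop))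
  have h' := hasSum_integral_nuDisc (hP.integrable_nuDisc
    (f := fun x => (x - b) ^ 2) (by fun_prop))
  have hs := h.sub h'
  have hf := hasSum_sum_of_ne_finset_zero (f := fun j => (1 / 2 : ℝ) ^ (j + 1) *
    min ((aseq j - a) ^ 2) ((aseq j - b) ^ 2) - (1 / 2 : ℝ) ^ (j + 1) * (aseq j - b) ^ 2)
    (s := Finset.range k) (L := SummationFilter.unconditional ℕ) (by
      intro j hj
      rw [min_sq_eq_right hab (hr j (by simpa using hj)), sub_self])
  have he := hs.unique hf
  have hsum : ∑ j ∈ Finset.range k, ((1 / 2 : ℝ) ^ (j + 1) *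
      min ((aseq j - a) ^ 2) ((aseq j - b) ^ 2) - (1 / 2 : ℝ) ^ (j + 1) * (aseq j - b) ^ 2)
      = (a ^ 2 - b ^ 2) * ∑ j ∈ Finset.range k, (1 / 2 : ℝ) ^ (j + 1)
        - 2 * (a - b) * ∑ j ∈ Finset.range k, (1 / 2 : ℝ) ^ (j + 1) * aseq j := by
    rw [Finset.mul_sum, Finset.mul_sum, ← Finset.sum_sub_distrib]
    refine Finset.sum_congr rfl fun j hj => ?_
    rw [min_sq_eq_left hab (hl j (by simpa using hj))]
    ring
  rw [hsum, sum_range_weight, sum_range_weight_mul_aseq, hP.integral_nuDisc_sub_sq] at he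
  linarith

lemma integral_nuDisc_min_left {P : Measure ℝ} (hP : IsCondensation P nuDisc) {a b : ℝ}
    (hab : a ≤ b) (h : 6 / 5 ≤ a + b) :
    ∫ x, min ((x - a) ^ 2) ((x - b) ^ 2) ∂nuDisc = 39 / 175 - 2 * a * (7 / 15) + a ^ 2 := by
  rw [← hP.integral_nuDisc_sub_sq]
  refine integral_congr_ae (ae_nuDisc fun j => min_sq_eq_left hab ?_)
  linarith [(aseq_mem j).2]

lemma integral_nuDisc_min_right {P : Measure ℝ} (hP : IsCondensation P nuDisc) {a b : ℝ}
    (hab : a ≤ b) (h : a + b ≤ 4 / 5) :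
    ∫ x, min ((x - a) ^ 2) ((x - b) ^ 2) ∂nuDisc = 39 / 175 - 2 * b * (7 / 15) + b ^ 2 := by
  rw [← hP.integral_nuDisc_sub_sq]
  refine integral_congr_ae (ae_nuDisc fun j => min_sq_eq_right hab ?_)
  linarith [(aseq_mem j).1]

lemma integral_S1_min {P : Measure ℝ} (hP : IsCondensation P nuDisc) {a b : ℝ}
    (hab : a ≤ b) (h : 2 / 5 ≤ a + b) :
    ∫ x, min ((x / 5 - a) ^ 2) ((x / 5 - b) ^ 2) ∂P =
      6953 / 498225 - 2 * a * (19 / 195) + a ^ 2 := by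
  rw [← hP.integral_S1_sub_sq]
  refine integral_congr_ae ?_
  filter_upwards [hP.ae_mem_Icc] with x hx
  exact min_sq_eq_left hab (by linarith [hx.2])

lemma integral_S2_min {P : Measure ℝ} (hP : IsCondensation P nuDisc) {a b : ℝ}
    (hab : a ≤ b) (h : a + b ≤ 8 / 5) :
    ∫ x, min ((x / 5 + 4 / 5 - a) ^ 2) ((x / 5 + 4 / 5 - b) ^ 2) ∂P =
      6953 / 498225 + 152 / 975 + 16 / 25 - 2 * b * (175 / 195) + b ^ 2 := by
  rw [← hP.integral_S2_sub_sq]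
  refine integral_congr_ae ?_
  filter_upwards [hP.ae_mem_Icc] with x hx
  exact min_sq_eq_right hab (by linarith [hx.1])

lemma distortion_pair_eq_split {P : Measure ℝ} (hP : IsCondensation P nuDisc) {a b : ℝ}
    (hab : a ≤ b) (h : 2 / 5 ≤ a + b) (h' : a + b ≤ 8 / 5) {k : ℕ}
    (hl : ∀ j < k, 2 * aseq j ≤ a + b) (hr : ∀ j, k ≤ j → a + b ≤ 2 * aseq j) :
    3 * distortion P {a, b} = splitDistortion ((1 / 2) ^ k) a b := by
  rw [hP.distortion_pair, hP.integral_S1_min hab h, hP.integral_S2_min hab h',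
    hP.integral_nuDisc_min hab hl hr, splitDistortion]
  ring

lemma lt_distortion_pair_of_lt {P : Measure ℝ} (hP : IsCondensation P nuDisc) {a b : ℝ}
    (hab : a ≤ b) (h : a + b < 4 / 5) :
    499067 / 18505500 < distortion P {a, b} := by
  have hd := hP.distortion_pair a b
  rw [hP.integral_S2_min hab (by linarith), hP.integral_nuDisc_min_right hab h.le] at hd
  have h0 : 0 ≤ ∫ x, min ((x / 5 - a) ^ 2) ((x / 5 - b) ^ 2) ∂P :=
    integral_nonneg fun x => le_min (sq_nonneg _) (sq_nonneg _)
  nlinarith [sq_nonneg (b - (175 / 195 + 7 / 15) / 2)]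

lemma lt_distortion_pair_of_gt {P : Measure ℝ} (hP : IsCondensation P nuDisc) {a b : ℝ}
    (hab : a ≤ b) (h : 8 / 5 < a + b) :
    499067 / 18505500 < distortion P {a, b} := by
  have := hP.1
  have hd := hP.distortion_pair a b
  rw [hP.integral_S1_min hab (by linarith), hP.integral_nuDisc_min_left hab (by linarith)] at hd
  rcases le_or_gt a (1 / 2) with ha | ha
  · have h0 : (1 / 100 : ℝ) ≤
        ∫ x, min ((x / 5 + 4 / 5 - a) ^ 2) ((x / 5 + 4 / 5 - b) ^ 2) ∂P := by
      have hc : (1 / 100 : ℝ) = ∫ _, 1 / 100 ∂P := by simp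
      rw [hc]
      refine integral_mono_ae (integrable_const _) (hP.integrable (by fun_prop)) ?_
      filter_upwards [hP.ae_mem_Icc] with x hx
      have := hx.1
      have := hx.2
      exact le_min (by nlinarith) (by nlinarith)
    nlinarith [sq_nonneg (a - (19 / 195 + 7 / 15) / 2)]
  · have h0 : 0 ≤ ∫ x, min ((x / 5 + 4 / 5 - a) ^ 2) ((x / 5 + 4 / 5 - b) ^ 2) ∂P :=
      integral_nonneg fun x => le_min (sq_nonneg _) (sq_nonneg _)
    nlinarith

end IsCondensation

lemma splitDistortion_eq {q : ℝ} (a b : ℝ) (h0 : 2 - q ≠ 0) (h1 : 1 + q ≠ 0) :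
    splitDistortion q a b = 499067 / 6168500
      + (2 - q) * (a - (19 / 195 + 7 / 15 - 3 / 5 * q + 2 / 15 * q ^ 2) / (2 - q)) ^ 2
      + (1 + q) * (b - (175 / 195 + 3 / 5 * q - 2 / 15 * q ^ 2) / (1 + q)) ^ 2
      + (747 / 295750 - 42559 / 1774500 * q + 64399 / 1774500 * q ^ 2 + 88 / 975 * q ^ 3
        - 4 / 75 * q ^ 4) / ((2 - q) * (1 + q)) := by
  unfold splitDistortion
  field_simp
  ring

lemma lt_splitDistortion {q : ℝ} (a b : ℝ) (h0 : 0 ≤ q) (h1 : q ≤ 1 / 8 ∨ q = 1 / 2) :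
    499067 / 6168500 < splitDistortion q a b := by
  have hq : q ≤ 1 / 2 := by rcases h1 with h | h <;> linarith
  have h2 : 0 < 2 - q := by linarith
  have h3 : 0 < 1 + q := by linarith
  rw [splitDistortion_eq a b h2.ne' h3.ne']
  have h4 : 0 < 747 / 295750 - 42559 / 1774500 * q + 64399 / 1774500 * q ^ 2
      + 88 / 975 * q ^ 3 - 4 / 75 * q ^ 4 := by
    rcases h1 with h | rfl
    · have : q ^ 4 ≤ q ^ 3 := pow_le_pow_of_le_one h0 (by linarith) (by norm_num)
      have : 0 ≤ q ^ 3 := by positivity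
      nlinarith [sq_nonneg (q - 1 / 8)]
    · norm_num
  have h5 := div_pos h4 (mul_pos h2 h3)
  have h6 := mul_nonneg h2.le (sq_nonneg
    (a - (19 / 195 + 7 / 15 - 3 / 5 * q + 2 / 15 * q ^ 2) / (2 - q)))
  have h7 := mul_nonneg h3.le (sq_nonneg
    (b - (175 / 195 + 3 / 5 * q - 2 / 15 * q ^ 2) / (1 + q)))
  linarith

lemma splitDistortion_quarter (a b : ℝ) :
    splitDistortion (1 / 4) a b = 499067 / 6168500
      + 7 / 4 * (a - 659 / 2730) ^ 2 + 5 / 4 * (b - 1621 / 1950) ^ 2 := by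
  unfold splitDistortion
  ring

lemma exists_aseq_split {a b : ℝ} (h0 : 4 / 5 ≤ a + b) (h1 : a + b < 6 / 5) :
    ∃ k : ℕ, 1 ≤ k ∧ (∀ j < k, 2 * aseq j ≤ a + b) ∧ ∀ j, k ≤ j → a + b ≤ 2 * aseq j := by
  classical
  have hex : ∃ k, a + b < 2 * aseq k := by
    obtain ⟨k, hk⟩ := exists_pow_lt_of_lt_one (show 0 < 6 / 5 - (a + b) by linarith)
      (show (1 / 2 : ℝ) < 1 by norm_num)
    refine ⟨k, ?_⟩
    rw [aseq_eq]
    have : (0 : ℝ) < (1 / 2) ^ k := by positivity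
    linarith
  refine ⟨Nat.find hex, ?_, fun j hj => not_lt.1 (Nat.find_min hex hj), fun j hj => ?_⟩
  · refine Nat.one_le_iff_ne_zero.2 fun h => ?_
    have := Nat.find_spec hex
    rw [h, aseq_eq] at this
    norm_num at this
    linarith
  · linarith [Nat.find_spec hex, monotone_aseq hj]

namespace IsCondensation

lemma distortion_optimal {P : Measure ℝ} (hP : IsCondensation P nuDisc) :
    distortion P {659 / 2730, 1621 / 1950} = 499067 / 18505500 := by
  have h := hP.distortion_pair_eq_split (a := 659 / 2730) (b := 1621 / 1950) (k := 2)
    (by norm_num) (by norm_num) (by norm_num)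
    (fun j hj => by
      have := monotone_aseq (Nat.le_of_lt_succ hj)
      have h1 : aseq 1 = 1 / 2 := by norm_num [aseq]
      linarith)
    (fun j hj => by
      have := monotone_aseq hj
      have h2 : aseq 2 = 11 / 20 := by norm_num [aseq]
      linarith)
  have e : ((1 / 2 : ℝ) ^ 2) = 1 / 4 := by norm_num
  rw [e, splitDistortion_quarter] at h
  linarith

lemma distortion_pair_ge {P : Measure ℝ} (hP : IsCondensation P nuDisc) {a b : ℝ}
    (hab : a ≤ b) :
    499067 / 18505500 < distortion P {a, b} ∨
      3 * distortion P {a, b} = splitDistortion (1 / 4) a b := by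
  rcases lt_or_ge (a + b) (4 / 5) with h | h
  · exact Or.inl (hP.lt_distortion_pair_of_lt hab h)
  rcases lt_or_ge (8 / 5) (a + b) with h' | h'
  · exact Or.inl (hP.lt_distortion_pair_of_gt hab h')
  rcases lt_or_ge (a + b) (6 / 5) with h2 | h2
  · obtain ⟨k, hk, hl, hr⟩ := exists_aseq_split h h2
    have hd := hP.distortion_pair_eq_split hab (by linarith) h' hl hr
    by_cases hk2 : k = 2
    · subst hk2
      right
      rw [hd]
      norm_num
    · left
      have hlt := lt_splitDistortion (q := (1 / 2) ^ k) a b (by positivity) (by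
        by_cases hk1 : k = 1
        · right
          rw [hk1, pow_one]
        · left
          calc (1 / 2 : ℝ) ^ k ≤ (1 / 2) ^ 3 :=
                pow_le_pow_of_le_one (by norm_num) (by norm_num) (by lia)
            _ = 1 / 8 := by norm_num)
      linarith
  · left
    have hd := hP.distortion_pair a b
    rw [hP.integral_S1_min hab (by linarith), hP.integral_S2_min hab h',
      hP.integral_nuDisc_min_left hab h2] at hd
    have hlt := lt_splitDistortion (q := 0) a b le_rfl (by norm_num)
    unfold splitDistortion at hlt
    linarith

end IsCondensation

lemma exists_eq_pair {α : Set ℝ} (hf : α.Finite) (hn : α.Nonempty) (hc : α.ncard ≤ 2) :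
    ∃ a b : ℝ, a ≤ b ∧ α = {a, b} := by
  have hpos := (Set.ncard_pos hf).2 hn
  obtain h | h : α.ncard = 1 ∨ α.ncard = 2 := by lia
  · obtain ⟨a, rfl⟩ := Set.ncard_eq_one.1 h
    exact ⟨a, a, le_rfl, by simp⟩
  · obtain ⟨a, b, -, rfl⟩ := Set.ncard_eq_two.1 h
    rcases le_total a b with hab | hab
    · exact ⟨a, b, hab, rfl⟩
    · exact ⟨b, a, hab, Set.pair_comm a b⟩

theorem optimal_two_means_discrete (P : MeasureTheory.Measure ℝ)
    (hP : IsCondensation P nuDisc) :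
    (∀ α : Set ℝ, IsOptimalSet P 2 α → α = {659 / 2730, 1621 / 1950}) ∧
      quantErr P 2 = 499067 / 18505500 := by
  have hq : quantErr P 2 = 499067 / 18505500 := by
    refine IsLeast.csInf_eq ⟨⟨{659 / 2730, 1621 / 1950}, by simp, by simp,
      (Set.ncard_insert_le _ _).trans (by simp), hP.distortion_optimal.symm⟩, ?_⟩
    rintro e ⟨α, hf, hn, hc, rfl⟩
    obtain ⟨a, b, hab, rfl⟩ := exists_eq_pair hf hn hc
    rcases hP.distortion_pair_ge hab with h | h
    · exact h.le
    · rw [splitDistortion_quarter] at h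
      linarith [sq_nonneg (a - 659 / 2730), sq_nonneg (b - 1621 / 1950)]
  refine ⟨fun α hα => ?_, hq⟩
  obtain ⟨hf, hn, hc, hd⟩ := hα
  rw [hq] at hd
  obtain ⟨a, b, hab, rfl⟩ := exists_eq_pair hf hn hc
  rcases hP.distortion_pair_ge hab with h | h
  · exact absurd hd h.ne'
  · rw [splitDistortion_quarter, hd] at h
    have ha := sq_nonneg (a - 659 / 2730)
    have hb := sq_nonneg (b - 1621 / 1950)
    have ha' : (a - 659 / 2730) ^ 2 = 0 := by linarith
    have hb' : (b - 1621 / 1950) ^ 2 = 0 := by linarith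
    rw [sub_eq_zero.1 (pow_eq_zero_iff two_ne_zero |>.1 ha'),
      sub_eq_zero.1 (pow_eq_zero_iff two_ne_zero |>.1 hb')]
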